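/- arXiv:2511.21906 — 5 statements merged into one kernel-verified Lean document; each statement's English description precedes it below -/
import Mathlib

section
/- Let ω be a real random variable with Laplace(0,1) distribution (CDF G), let γ^d be a Bernoulli random variable independent of ω with P(γ^d = 1) = 1 − p for some p ∈ (0,1), fix u ∈ ℝ and C ≥ 0, and define z = 1 − 2·1_{{u + ω ≤ 0}}, γ^e = 1_{{|u + ω| > C}}, and ŝ = γ^d γ^e z / (1 − p). Then E[ŝ] = G(u − C) − G(−u − C); that is, the packet-loss-compensated reconstruction ŝ is an unbiased reconstruction of the expected triggered one-bit signal. -/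
open MeasureTheory ProbabilityTheory

/-- The Laplace(0,1) cumulative distribution function:
`G(t) = (1/2)e^t` for `t ≤ 0` and `G(t) = 1 - (1/2)e^{-t}` for `t > 0`. -/
noncomputable def laplaceCDF (t : ℝ) : ℝ :=
  if t ≤ 0 then Real.exp t / 2 else 1 - Real.exp (-t) / 2

lemma continuous_laplaceCDF : Continuous laplaceCDF := by
  unfold laplaceCDF
  refine Continuous.if_le (by fun_prop) (by fun_prop) continuous_id continuous_const ?_
  rintro x rfl
  norm_num

lemma laplaceCDF_neg (t : ℝ) : laplaceCDF (-t) = 1 - laplaceCDF t := by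
  unfold laplaceCDF
  rcases lt_trichotomy t 0 with h | rfl | h
  · rw [if_neg (by linarith), if_pos h.le, neg_neg]
  · norm_num
  · rw [if_pos (by linarith), if_neg (by linarith)]
    ring

/-- A random variable whose cumulative distribution function `F` is continuous satisfies
`P(w < t) = F t`. -/
lemma measureReal_lt_of_continuous_cdf {Ω : Type*} [MeasurableSpace Ω] (μ : Measure Ω)
    [IsFiniteMeasure μ] {w : Ω → ℝ} {F : ℝ → ℝ} (hF : Continuous F)
    (hlaw : ∀ t, μ.real {a | w a ≤ t} = F t) (t : ℝ) : μ.real {a | w a < t} = F t := by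
  apply le_antisymm
  · rw [← hlaw t]
    exact measureReal_mono fun a (ha : w a < t) => ha.le
  · refine le_of_tendsto (hF.continuousAt.tendsto.mono_left
      (nhdsWithin_le_nhds (s := Set.Iio t))) ?_
    filter_upwards [self_mem_nhdsWithin] with s hs
    rw [← hlaw s]
    exact measureReal_mono fun a (ha : w a ≤ s) => lt_of_le_of_lt ha hs

/-- The triggered one-bit signal is the difference of two tail indicators. -/
lemma triggered_sign_eq_indicator_sub {C : ℝ} (hC : 0 ≤ C) (u x : ℝ) :
    (if C < |u + x| then (1 : ℝ) else 0) * (1 - 2 * (if u + x ≤ 0 then (1 : ℝ) else 0)) =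
      (Set.Ioi (C - u)).indicator 1 x - (Set.Iio (-u - C)).indicator 1 x := by
  simp only [Set.indicator_apply, Set.mem_Ioi, Set.mem_Iio, Pi.one_apply, lt_abs]
  split_ifs <;> grind

/-- If `ω` is Laplace(0,1)-distributed, `γ^d` is a Bernoulli
variable independent of `ω` with `P(γ^d = 1) = 1 - p`, `p ∈ (0,1)`, `u ∈ ℝ`,
`C ≥ 0`, `z = 1 - 2·1_{u+ω ≤ 0}`, `γ^e = 1_{|u+ω| > C}`, and
`ŝ = γ^d γ^e z/(1-p)`, then `E[ŝ] = G(u - C) - G(-u - C)`: the packet-loss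
compensated reconstruction is unbiased. -/
theorem packet_loss_reconstruction_unbiased
    {Ωs : Type*} [MeasurableSpace Ωs] (μ : Measure Ωs) [IsProbabilityMeasure μ]
    (w : Ωs → ℝ) (hw : Measurable w)
    (hlaw : ∀ t : ℝ, (μ {a | w a ≤ t}).toReal = laplaceCDF t)
    (γd : Ωs → ℝ) (hγd_meas : Measurable γd)
    (hγd_01 : ∀ a, γd a = 0 ∨ γd a = 1)
    (p : ℝ) (hp : 0 < p) (hp1 : p < 1)
    (hγd_law : (μ {a | γd a = 1}).toReal = 1 - p)
    (hindep : IndepFun γd w μ)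
    (u C : ℝ) (hC : 0 ≤ C)
    (z γe shat : Ωs → ℝ)
    (hz : ∀ a, z a = 1 - 2 * (if u + w a ≤ 0 then (1 : ℝ) else 0))
    (hγe : ∀ a, γe a = if C < |u + w a| then (1 : ℝ) else 0)
    (hshat : ∀ a, shat a = γd a * γe a * z a / (1 - p)) :
    ∫ a, shat a ∂μ = laplaceCDF (u - C) - laplaceCDF (-u - C) := by
  let f : ℝ → ℝ := fun x =>
    (Set.Ioi (C - u)).indicator 1 x - (Set.Iio (-u - C)).indicator 1 x
  have hf : Measurable f :=
    (measurable_one.indicator measurableSet_Ioi).sub (measurable_one.indicator measurableSet_Iio)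
  have hshat_eq : shat = fun a => γd a * f (w a) / (1 - p) := by
    funext a
    rw [hshat, hz, hγe, mul_assoc, triggered_sign_eq_indicator_sub hC]
  have hγd_int : ∫ a, γd a ∂μ = 1 - p := by
    have hγd_eq : γd = (γd ⁻¹' {1}).indicator 1 := by
      funext a
      rcases hγd_01 a with h | h <;> simp [h]
    rw [hγd_eq, integral_indicator_one (hγd_meas (measurableSet_singleton 1))]
    exact hγd_law
  have htail : ∀ s : Set ℝ, MeasurableSet s →
      Integrable (fun a => s.indicator (1 : ℝ → ℝ) (w a)) μ ∧
        ∫ a, s.indicator (1 : ℝ → ℝ) (w a) ∂μ = μ.real (w ⁻¹' s) := fun s hs =>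
    ⟨(integrable_const (1 : ℝ)).indicator (hw hs), integral_indicator_one (hw hs)⟩
  have hupper : μ.real (w ⁻¹' Set.Ioi (C - u)) = laplaceCDF (u - C) := by
    rw [← neg_sub C u, laplaceCDF_neg, ← hlaw, ← Set.compl_Iic, Set.preimage_compl,
      probReal_compl_eq_one_sub (hw measurableSet_Iic)]
    rfl
  have hlower : μ.real (w ⁻¹' Set.Iio (-u - C)) = laplaceCDF (-u - C) :=
    measureReal_lt_of_continuous_cdf μ continuous_laplaceCDF hlaw _
  have hf_int : ∫ a, f (w a) ∂μ = laplaceCDF (u - C) - laplaceCDF (-u - C) := by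
    rw [integral_sub (htail _ measurableSet_Ioi).1 (htail _ measurableSet_Iio).1,
      (htail _ measurableSet_Ioi).2, (htail _ measurableSet_Iio).2, hupper, hlower]
  have hprod : ∫ a, γd a * f (w a) ∂μ = (∫ a, γd a ∂μ) * ∫ a, f (w a) ∂μ :=
    (hindep.comp measurable_id hf).integral_fun_mul_eq_mul_integral
      hγd_meas.aestronglyMeasurable (hf.comp hw).aestronglyMeasurable
  rw [hshat_eq, integral_div, hprod, hγd_int, hf_int, mul_div_cancel_left₀ _ (by linarith)]
end

section
/- Let ω be a real random variable with Laplace(0,1) distribution (CDF G), let γ^d be a Bernoulli random variable independent of ω with P(γ^d = 1) = 1 − p for some p ∈ (0,1). Fix M ≥ 0, ν > 0, and a real k ≥ 1 with ν ln k ≥ M, set C = ν ln k, and fix u, u′ ∈ ℝ with |u| ≤ M and |u′| ≤ M. Define z = 1 − 2·1_{{u + ω ≤ 0}}, γ^e = 1_{{|u + ω| > C}}, ŝ = γ^d γ^e z / (1 − p), and a = G(u′ − C) − G(−u′ − C). Then E[(ŝ − a)²] ≤ ( e^{M}/(1 − p) + 3 e^{2M} ) · k^{−ν}. -/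
open MeasureTheory ProbabilityTheory

lemma laplaceCDF_of_nonpos {t : ℝ} (ht : t ≤ 0) : laplaceCDF t = Real.exp t / 2 :=
  if_pos ht

/-- The complementary form of the right tail, valid also at `t = 0`. -/
lemma one_sub_laplaceCDF_of_nonneg {t : ℝ} (ht : 0 ≤ t) :
    1 - laplaceCDF t = Real.exp (-t) / 2 := by
  rcases ht.eq_or_lt with rfl | ht
  · norm_num [laplaceCDF]
  · rw [laplaceCDF, if_neg ht.not_ge]
    ring

/-- Two-sided tail bound for a shifted Laplace variable. -/
lemma measureReal_lt_abs_add_le_of_laplaceCDF {Ω : Type*} [MeasurableSpace Ω] {μ : Measure Ω}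
    [IsProbabilityMeasure μ] {w : Ω → ℝ} (hw : Measurable w)
    (hlaw : ∀ t : ℝ, μ.real {x | w x ≤ t} = laplaceCDF t)
    {M C u : ℝ} (hMC : M ≤ C) (hu : |u| ≤ M) :
    μ.real {x | C < |u + w x|} ≤ Real.exp (M - C) := by
  obtain ⟨hu₁, hu₂⟩ := abs_le.mp hu
  have hsub : {x | C < |u + w x|} ⊆ {x | w x ≤ -u - C} ∪ {x | w x ≤ C - u}ᶜ := by
    intro x hx
    rcases lt_abs.mp (show C < |u + w x| from hx) with h | h
    · right
      simp only [Set.mem_compl_iff, Set.mem_ofPred_eq, not_le]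
      linarith
    · left
      show w x ≤ -u - C
      linarith
  calc μ.real {x | C < |u + w x|}
      ≤ μ.real {x | w x ≤ -u - C} + μ.real {x | w x ≤ C - u}ᶜ :=
        (measureReal_mono hsub).trans (measureReal_union_le _ _)
    _ = Real.exp (-u - C) / 2 + Real.exp (-(C - u)) / 2 := by
        rw [probReal_compl_eq_one_sub (measurableSet_le hw measurable_const), hlaw, hlaw,
          laplaceCDF_of_nonpos (by linarith), one_sub_laplaceCDF_of_nonneg (by linarith)]
    _ ≤ Real.exp (M - C) := by
        have h₁ : Real.exp (-u - C) ≤ Real.exp (M - C) := Real.exp_le_exp.mpr (by linarith)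
        have h₂ : Real.exp (-(C - u)) ≤ Real.exp (M - C) := Real.exp_le_exp.mpr (by linarith)
        linarith

lemma abs_laplaceCDF_sub_le {M C u : ℝ} (hMC : M ≤ C) (hu : |u| ≤ M) :
    |laplaceCDF (u - C) - laplaceCDF (-u - C)| ≤ Real.exp (M - C) := by
  obtain ⟨hu₁, hu₂⟩ := abs_le.mp hu
  rw [laplaceCDF_of_nonpos (by linarith), laplaceCDF_of_nonpos (by linarith)]
  have h₁ : Real.exp (u - C) ≤ Real.exp (M - C) := Real.exp_le_exp.mpr (by linarith)
  have h₂ : Real.exp (-u - C) ≤ Real.exp (M - C) := Real.exp_le_exp.mpr (by linarith)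
  have h₃ := Real.exp_pos (u - C)
  have h₄ := Real.exp_pos (-u - C)
  exact abs_le.mpr ⟨by linarith, by linarith⟩

/-- With `ω ~ Laplace(0,1)`, `γ^d` Bernoulli(`1-p`) independent
of `ω`, `M ≥ 0`, `ν > 0`, `k ≥ 1` with `ν ln k ≥ M`, threshold `C = ν ln k`,
`|u| ≤ M`, `|u′| ≤ M`, `z = 1 - 2·1_{u+ω ≤ 0}`, `γ^e = 1_{|u+ω| > C}`,
`ŝ = γ^d γ^e z/(1-p)` and `a = G(u′ - C) - G(-u′ - C)`, one has
`E[(ŝ - a)²] ≤ (e^M/(1-p) + 3 e^{2M}) k^{-ν}`. -/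
theorem packet_loss_innovation_second_moment_bound
    {Ωs : Type*} [MeasurableSpace Ωs] (μ : Measure Ωs) [IsProbabilityMeasure μ]
    (w : Ωs → ℝ) (hw : Measurable w)
    (hlaw : ∀ t : ℝ, (μ {x | w x ≤ t}).toReal = laplaceCDF t)
    (γd : Ωs → ℝ) (hγd_meas : Measurable γd)
    (hγd_01 : ∀ x, γd x = 0 ∨ γd x = 1)
    (p : ℝ) (hp : 0 < p) (hp1 : p < 1)
    (hγd_law : (μ {x | γd x = 1}).toReal = 1 - p)
    (hindep : IndepFun γd w μ)
    (M ν k : ℝ) (hM : 0 ≤ M) (hν : 0 < ν) (hk : 1 ≤ k) (hMk : M ≤ ν * Real.log k)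
    (C : ℝ) (hC : C = ν * Real.log k)
    (u u' : ℝ) (hu : |u| ≤ M) (hu' : |u'| ≤ M)
    (z γe shat : Ωs → ℝ)
    (hz : ∀ x, z x = 1 - 2 * (if u + w x ≤ 0 then (1 : ℝ) else 0))
    (hγe : ∀ x, γe x = if C < |u + w x| then (1 : ℝ) else 0)
    (hshat : ∀ x, shat x = γd x * γe x * z x / (1 - p))
    (a : ℝ) (ha : a = laplaceCDF (u' - C) - laplaceCDF (-u' - C)) :
    ∫ x, (shat x - a) ^ 2 ∂μ ≤
      (Real.exp M / (1 - p) + 3 * Real.exp (2 * M)) * k ^ (-ν) := by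
  have hq : 0 < 1 - p := sub_pos.mpr hp1
  have hMC : M ≤ C := hC ▸ hMk
  have hkC : k ^ (-ν) = Real.exp (-C) := by
    rw [Real.rpow_def_of_pos (by linarith), hC]
    ring_nf
  set S : Set ℝ := {t | C < |u + t|}
  have hS : MeasurableSet S := measurableSet_lt measurable_const (by fun_prop)
  set B : Set Ωs := γd ⁻¹' {1} ∩ w ⁻¹' S
  have hB : MeasurableSet B := (hγd_meas (measurableSet_singleton 1)).inter (hw hS)
  have hPA : μ.real (w ⁻¹' S) ≤ Real.exp (M - C) :=
    measureReal_lt_abs_add_le_of_laplaceCDF hw hlaw hMC hu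
  have hPB : μ.real B = (1 - p) * μ.real (w ⁻¹' S) := by
    rw [measureReal_def, hindep.measure_inter_preimage_eq_mul _ _ (measurableSet_singleton 1) hS,
      ENNReal.toReal_mul, ← hγd_law]
    rfl
  have ha' : |a| ≤ Real.exp (M - C) := ha ▸ abs_laplaceCDF_sub_le hMC hu'
  have habs : ∀ x, |shat x| = B.indicator (fun _ => 1 / (1 - p)) x := by
    intro x
    rw [hshat, hγe, hz, abs_div, abs_of_pos hq]
    by_cases hx : x ∈ B
    · obtain ⟨hx₁, hx₂⟩ := id hx
      rw [Set.indicator_of_mem hx, show γd x = 1 from hx₁,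
        if_pos (show C < |u + w x| from hx₂)]
      split_ifs <;> norm_num
    · rw [Set.indicator_of_notMem hx]
      rcases hγd_01 x with h | h
      · simp [h]
      · have hx₂ : ¬ C < |u + w x| := fun h₂ => hx ⟨h, h₂⟩
        simp [hx₂]
  have hpt : ∀ x, (shat x - a) ^ 2 ≤
      B.indicator (fun _ => (1 / (1 - p)) ^ 2 + 2 * |a| * (1 / (1 - p))) x + a ^ 2 := by
    intro x
    have h₁ : (shat x - a) ^ 2 ≤ |shat x| ^ 2 + 2 * |a| * |shat x| + a ^ 2 := by
      have h := neg_abs_le (shat x * a)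
      rw [abs_mul] at h
      rw [sq_abs]
      linarith
    refine h₁.trans_eq ?_
    rw [habs]
    by_cases hx : x ∈ B <;> simp [hx]
  have hint : Integrable
      (B.indicator (fun _ => (1 / (1 - p)) ^ 2 + 2 * |a| * (1 / (1 - p)))) μ :=
    (integrable_const _).indicator hB
  calc ∫ x, (shat x - a) ^ 2 ∂μ
      ≤ ∫ x, (B.indicator (fun _ => (1 / (1 - p)) ^ 2 + 2 * |a| * (1 / (1 - p))) x + a ^ 2) ∂μ :=
        integral_mono_of_nonneg (.of_forall fun _ => sq_nonneg _)
          (hint.add (integrable_const _)) (.of_forall hpt)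
    _ = μ.real (w ⁻¹' S) / (1 - p) + 2 * |a| * μ.real (w ⁻¹' S) + |a| ^ 2 := by
        rw [integral_add hint (integrable_const _), integral_indicator_const _ hB, hPB,
          integral_const, probReal_univ, sq_abs]
        simp only [smul_eq_mul]
        field_simp
    _ ≤ Real.exp (M - C) / (1 - p) + 2 * Real.exp (M - C) * Real.exp (M - C)
          + Real.exp (M - C) ^ 2 := by
        gcongr
    _ = Real.exp M / (1 - p) * Real.exp (-C)
          + 3 * Real.exp (2 * M) * (Real.exp (-C) * Real.exp (-C)) := by
        rw [sub_eq_add_neg, Real.exp_add, two_mul M, Real.exp_add]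
        ring
    _ ≤ Real.exp M / (1 - p) * Real.exp (-C) + 3 * Real.exp (2 * M) * (Real.exp (-C) * 1) := by
        gcongr
        exact Real.exp_le_one_iff.mpr (by linarith)
    _ = (Real.exp M / (1 - p) + 3 * Real.exp (2 * M)) * k ^ (-ν) := by
        rw [hkC]
        ring
end

section
/- Let G be the Laplace(0,1) cumulative distribution function (G(t) = (1/2)e^{t} for t ≤ 0, G(t) = 1 − (1/2)e^{−t} for t > 0), fix C ≥ 0, and define H(x) = G(x − C) − G(−x − C). Then for every M ≥ 0 and all a, b ∈ [−M, M]: (H(a) − H(b))(a − b) ≥ (1/2) e^{−M} e^{−C} (a − b)². -/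
theorem exp_neg_mul_sub_le_exp_sub_exp {K u v : ℝ} (hv : -K ≤ v) (huv : v ≤ u) :
    Real.exp (-K) * (u - v) ≤ Real.exp u - Real.exp v := by
  have h₁ : Real.exp (-K) * (u - v) ≤ Real.exp v * (u - v) :=
    mul_le_mul_of_nonneg_right (Real.exp_le_exp.mpr hv) (sub_nonneg.mpr huv)
  have h₂ : Real.exp v * (u - v + 1) ≤ Real.exp v * Real.exp (u - v) :=
    mul_le_mul_of_nonneg_left (Real.add_one_le_exp _) (Real.exp_pos _).le
  rw [← Real.exp_add, add_sub_cancel] at h₂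
  linarith

/-- On `[-K, K]` the Laplace distribution function grows at rate at least `e^{-K} / 2`. -/
theorem laplaceCDF_sub_ge {K s t : ℝ} (ht : -K ≤ t) (hts : t ≤ s) (hs : s ≤ K) :
    Real.exp (-K) / 2 * (s - t) ≤ laplaceCDF s - laplaceCDF t := by
  unfold laplaceCDF
  split_ifs with h₁ h₂ h₂
  · linarith [exp_neg_mul_sub_le_exp_sub_exp ht hts]
  · linarith
  · have h₃ := exp_neg_mul_sub_le_exp_sub_exp ht h₂
    have h₄ := exp_neg_mul_sub_le_exp_sub_exp (neg_le_neg hs) (by linarith : -s ≤ 0)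
    rw [Real.exp_zero] at h₃ h₄
    linarith
  · linarith [exp_neg_mul_sub_le_exp_sub_exp (neg_le_neg hs) (neg_le_neg hts)]

/-- The triggered encoder mean is increasing on `[-M, M]` at rate at least `e^{-(M + C)} / 2`. -/
theorem laplaceCDF_encoder_sub_ge {C M a b : ℝ} (hC : 0 ≤ C) (hb : -M ≤ b) (hba : b ≤ a)
    (ha : a ≤ M) :
    Real.exp (-(M + C)) / 2 * (a - b) ≤
      (laplaceCDF (a - C) - laplaceCDF (-a - C)) -
        (laplaceCDF (b - C) - laplaceCDF (-b - C)) := by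
  have h₁ := laplaceCDF_sub_ge (K := M + C) (s := a - C) (t := b - C)
    (by linarith) (by linarith) (by linarith)
  have h₂ := laplaceCDF_sub_ge (K := M + C) (s := -b - C) (t := -a - C)
    (by linarith) (by linarith) (by linarith)
  have h₃ : 0 ≤ Real.exp (-(M + C)) / 2 * (a - b) :=
    mul_nonneg (by positivity) (sub_nonneg.mpr hba)
  linarith

/-- For `C ≥ 0` and `H(x) = G(x - C) - G(-x - C)` (the mean of
the triggered dithered one-bit encoder), `H` is strongly monotone on `[-M, M]`:
`(H(a) - H(b))(a - b) ≥ (1/2) e^{-M} e^{-C} (a - b)²` for all `a, b ∈ [-M, M]`. -/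
theorem triggered_encoder_strong_monotonicity
    (C : ℝ) (hC : 0 ≤ C)
    (H : ℝ → ℝ) (hH : ∀ x, H x = laplaceCDF (x - C) - laplaceCDF (-x - C))
    (M : ℝ) (hM : 0 ≤ M) (a b : ℝ)
    (ha : a ∈ Set.Icc (-M) M) (hb : b ∈ Set.Icc (-M) M) :
    (1 / 2) * Real.exp (-M) * Real.exp (-C) * (a - b) ^ 2 ≤ (H a - H b) * (a - b) := by
  rw [hH, hH, mul_assoc (1 / 2), ← Real.exp_add, ← neg_add]
  rcases le_total b a with h | h
  · have h₁ := mul_le_mul_of_nonneg_right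
      (laplaceCDF_encoder_sub_ge hC hb.1 h ha.2) (sub_nonneg.mpr h)
    linarith
  · have h₁ := mul_le_mul_of_nonneg_right
      (laplaceCDF_encoder_sub_ge hC ha.1 h hb.2) (sub_nonneg.mpr h)
    linarith
end

section
/- Let L ∈ ℝ^{m×m} be a symmetric positive semidefinite matrix with L·𝟙 = 0 (𝟙 the all-ones vector) whose second smallest eigenvalue λ₂ is positive (i.e., the kernel of L is exactly span(𝟙)). Let B₁, …, B_m be symmetric positive semidefinite n×n matrices with B_i ⪯ M·I_n for all i and Σ_{i=1}^m B_i ⪰ μ·I_n, where M, μ > 0. Let c > 0 and let ρ ≥ be a real number satisfying 0 ≤ ρ, ρ m ≤ μ, ρ ≤ c λ₂, and (μ − ρ m)(c λ₂ − ρ) ≥ m M². Then the block matrix blockdiag(B₁, …, B_m) + c (L ⊗ I_n) ⪰ ρ · I_{mn}, where L ⊗ I_n is the Kronecker product acting on stacked vectors x = (x₁^T, …, x_m^T)^T ∈ ℝ^{mn}. -/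
open Matrix

/-- A symmetric real matrix whose kernel consists of constant vectors and whose nonzero eigenvalues
are at least `l` satisfies `l |v|² ≤ vᵀ L v` on vectors `v` with zero sum. -/
theorem mul_dotProduct_self_le_of_sum_eq_zero {m : ℕ} {L : Matrix (Fin m) (Fin m) ℝ}
    (hL : L.IsHermitian)
    (hker : ∀ v : Fin m → ℝ, L *ᵥ v = 0 → ∃ t : ℝ, v = fun _ => t) {l : ℝ}
    (hl : ∀ r : ℝ, r ≠ 0 → Module.End.HasEigenvalue (Matrix.toLin' L) r → l ≤ r)
    (v : Fin m → ℝ) (hv : ∑ i, v i = 0) :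
    l * (v ⬝ᵥ v) ≤ v ⬝ᵥ (L *ᵥ v) := by
  set u : Fin m → Fin m → ℝ := fun k => (hL.eigenvectorBasis k).ofLp with hu
  have parseval : ∀ w z : Fin m → ℝ, w ⬝ᵥ z = ∑ k, (w ⬝ᵥ u k) * (u k ⬝ᵥ z) := by
    intro w z
    have h := hL.eigenvectorBasis.sum_inner_mul_inner (WithLp.toLp 2 w) (WithLp.toLp 2 z)
    simp only [EuclideanSpace.inner_eq_star_dotProduct, star_trivial] at h
    rw [dotProduct_comm w z, ← h]
    refine Finset.sum_congr rfl fun k _ => ?_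
    rw [dotProduct_comm w, dotProduct_comm (u k) z]
  have heig : ∀ k, L *ᵥ u k = hL.eigenvalues k • u k := fun k => hL.mulVec_eigenvectorBasis k
  have hne : ∀ k, u k ≠ 0 := fun k h =>
    hL.eigenvectorBasis.toBasis.ne_zero k (by
      rw [OrthonormalBasis.coe_toBasis]
      ext i
      exact congrFun h i)
  rw [parseval v v, parseval v (L *ᵥ v), Finset.mul_sum]
  refine Finset.sum_le_sum fun k _ => ?_
  have hLk : u k ⬝ᵥ (L *ᵥ v) = hL.eigenvalues k * (u k ⬝ᵥ v) := by
    have hT : Lᵀ = L := by simpa using hL.eq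
    rw [dotProduct_mulVec, ← mulVec_transpose, hT, heig, smul_dotProduct, smul_eq_mul]
  rw [hLk, dotProduct_comm v (u k)]
  by_cases h0 : hL.eigenvalues k = 0
  · obtain ⟨t, ht⟩ := hker (u k) (by rw [heig, h0, zero_smul])
    have : u k ⬝ᵥ v = 0 := by
      rw [ht]
      simp [dotProduct, ← Finset.mul_sum, hv]
    simp [this]
  · have := hl _ h0 (Module.End.hasEigenvalue_of_hasEigenvector (x := u k)
      ⟨Module.End.mem_eigenspace_iff.2 (by rw [Matrix.toLin'_apply, heig]), hne k⟩)
    nlinarith [mul_self_nonneg (u k ⬝ᵥ v)]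

/-- If `0 ⪯ B ⪯ M I` then `4 s aᵀ B y ≥ -M |s a - y|²`. -/
theorem neg_mul_dotProduct_sub_le_of_le_smul_one {n : ℕ} {B : Matrix (Fin n) (Fin n) ℝ} {M : ℝ}
    (hB : B.PosSemidef) (hM : (M • (1 : Matrix (Fin n) (Fin n) ℝ) - B).PosSemidef)
    (s : ℝ) (a y : Fin n → ℝ) :
    -(M * (s ^ 2 * (a ⬝ᵥ a) - 2 * s * (a ⬝ᵥ y) + y ⬝ᵥ y)) ≤ 4 * s * (a ⬝ᵥ (B *ᵥ y)) := by
  have hsymm : y ⬝ᵥ (B *ᵥ a) = a ⬝ᵥ (B *ᵥ y) := by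
    have hT : Bᵀ = B := by simpa using hB.isHermitian.eq
    rw [dotProduct_mulVec, ← mulVec_transpose, hT, dotProduct_comm]
  have h1 := hB.dotProduct_mulVec_nonneg (s • a + y)
  have h2 := hM.dotProduct_mulVec_nonneg (s • a - y)
  simp only [star_trivial, sub_mulVec, smul_mulVec, one_mulVec, mulVec_add, mulVec_sub,
    mulVec_smul, dotProduct_add, dotProduct_sub, add_dotProduct, sub_dotProduct, smul_dotProduct,
    dotProduct_smul, smul_eq_mul, hsymm, dotProduct_comm y a] at h1 h2
  nlinarith

/-- If `L` is a symmetric PSD `m×m` matrix with `L𝟙 = 0`, kernel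
exactly `span(𝟙)` and smallest nonzero eigenvalue `λ₂ > 0`, and `B₁,…,B_m` are
symmetric PSD `n×n` matrices with `B_i ⪯ M·I` and `Σ B_i ⪰ μ·I`, and `c > 0`,
`0 ≤ ρ`, `ρm ≤ μ`, `ρ ≤ cλ₂`, `(μ - ρm)(cλ₂ - ρ) ≥ mM²`, then
`blockdiag(B₁,…,B_m) + c (L ⊗ I_n) ⪰ ρ I_{mn}` as a quadratic form on stacked
vectors `x = (x₁,…,x_m)`. -/
theorem excitation_laplacian_joint_lower_bound
    (m n : ℕ) (hm : 1 ≤ m) (hn : 1 ≤ n)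
    (L : Matrix (Fin m) (Fin m) ℝ)
    (hL_symm : L.IsSymm) (hL_psd : L.PosSemidef)
    (hL_one : L *ᵥ (fun _ => (1 : ℝ)) = 0)
    (hL_ker : ∀ v : Fin m → ℝ, L *ᵥ v = 0 → ∃ t : ℝ, v = fun _ => t)
    (lam2 : ℝ) (hlam2_pos : 0 < lam2)
    (hlam2 : IsLeast {r : ℝ | r ≠ 0 ∧ Module.End.HasEigenvalue (Matrix.toLin' L) r} lam2)
    (B : Fin m → Matrix (Fin n) (Fin n) ℝ)
    (hB_symm : ∀ i, (B i).IsSymm) (hB_psd : ∀ i, (B i).PosSemidef)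
    (M μ : ℝ) (hM : 0 < M) (hμ : 0 < μ)
    (hB_ub : ∀ i, (M • (1 : Matrix (Fin n) (Fin n) ℝ) - B i).PosSemidef)
    (hB_lb : ((∑ i, B i) - μ • (1 : Matrix (Fin n) (Fin n) ℝ)).PosSemidef)
    (c ρ : ℝ) (hc : 0 < c) (hρ0 : 0 ≤ ρ)
    (hρμ : ρ * m ≤ μ) (hrho_lam : ρ ≤ c * lam2)
    (hprod : m * M ^ 2 ≤ (μ - ρ * m) * (c * lam2 - ρ)) :
    ∀ x : Fin m → (Fin n → ℝ),
      ρ * ∑ i, ∑ t, (x i t) ^ 2 ≤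
        (∑ i, x i ⬝ᵥ (B i *ᵥ x i)) + c * ∑ i, ∑ j, L i j * (x i ⬝ᵥ x j) := by
  intro x
  have hm0 : (0 : ℝ) < m := by exact_mod_cast hm
  have hPQ : 0 < (μ - ρ * m) * (c * lam2 - ρ) := lt_of_lt_of_le (by positivity) hprod
  have hP : 0 < μ - ρ * m :=
    lt_of_le_of_ne (sub_nonneg.2 hρμ) fun h => by rw [← h, zero_mul] at hPQ; exact hPQ.false
  obtain ⟨a, ha⟩ : ∃ a : Fin n → ℝ, ∀ t, m * a t = ∑ i, x i t :=
    ⟨fun t => (∑ i, x i t) / m, fun t => by field_simp⟩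
  obtain ⟨y, hy⟩ : ∃ y : Fin m → Fin n → ℝ, ∀ i, x i = a + y i :=
    ⟨fun i => x i - a, fun i => by simp⟩
  have hy0 : ∀ t, ∑ i, y i t = 0 := by
    intro t
    have h := ha t
    simp only [hy, Pi.add_apply, Finset.sum_add_distrib, Finset.sum_const, Finset.card_univ,
      Fintype.card_fin, nsmul_eq_mul] at h
    linarith
  have hysum : ∑ i, y i = 0 := by
    ext t
    simpa using hy0 t
  have hay : ∑ i, a ⬝ᵥ y i = 0 := by
    rw [← dotProduct_sum, hysum, dotProduct_zero]
  set A := a ⬝ᵥ a with hA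
  set Y := ∑ i, y i ⬝ᵥ y i with hY
  have hA0 : 0 ≤ A := by simpa using dotProduct_star_self_nonneg a
  have hY0 : 0 ≤ Y := Finset.sum_nonneg fun i _ => by simpa using dotProduct_star_self_nonneg (y i)
  have hnorm : ∑ i, ∑ t, (x i t) ^ 2 = m * A + Y := by
    have h : ∀ i, ∑ t, (x i t) ^ 2 = A + 2 * (a ⬝ᵥ y i) + y i ⬝ᵥ y i := by
      intro i
      have : ∑ t, (x i t) ^ 2 = x i ⬝ᵥ x i := by simp [dotProduct, sq]
      rw [this, hy, add_dotProduct, dotProduct_add, dotProduct_add, dotProduct_comm (y i) a]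
      ring
    simp only [h, Finset.sum_add_distrib, ← Finset.mul_sum, hay]
    simp [hY]
  have hlap : lam2 * Y ≤ ∑ i, ∑ j, L i j * (x i ⬝ᵥ x j) := by
    have hrow : ∀ i, ∑ j, L i j = 0 := fun i => by
      simpa [mulVec, dotProduct] using congrFun hL_one i
    have hcol : ∀ j, ∑ i, L i j = 0 := fun j => by
      rw [← hrow j]
      exact Finset.sum_congr rfl fun i _ => hL_symm.apply j i
    have h1 : ∑ i, ∑ j, L i j * (x i ⬝ᵥ x j) = ∑ i, ∑ j, L i j * (y i ⬝ᵥ y j) := by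
      have e1 : ∑ i, ∑ j, L i j * (y i ⬝ᵥ a) = 0 := by
        simp [← Finset.sum_mul, hrow]
      have e2 : ∑ i, ∑ j, L i j * (a ⬝ᵥ y j) = 0 := by
        rw [Finset.sum_comm]
        simp [← Finset.sum_mul, hcol]
      have e3 : ∑ i, ∑ j, L i j * (a ⬝ᵥ a) = 0 := by
        simp [← Finset.sum_mul, hrow]
      simp only [hy, add_dotProduct, dotProduct_add, mul_add, Finset.sum_add_distrib, e1, e2, e3]
      ring
    have h2 : ∑ i, ∑ j, L i j * (y i ⬝ᵥ y j)
        = ∑ t, (fun i => y i t) ⬝ᵥ (L *ᵥ fun i => y i t) := by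
      simp only [dotProduct, mulVec, Finset.mul_sum]
      rw [Finset.sum_comm (s := (Finset.univ : Finset (Fin n)))]
      refine Finset.sum_congr rfl fun i _ => ?_
      rw [Finset.sum_comm]
      exact Finset.sum_congr rfl fun t _ => Finset.sum_congr rfl fun j _ => by ring
    have h3 : Y = ∑ t, (fun i => y i t) ⬝ᵥ (fun i => y i t) := by
      simp only [hY, dotProduct]
      rw [Finset.sum_comm]
    rw [h1, h2, h3, Finset.mul_sum]
    exact Finset.sum_le_sum fun t _ => mul_dotProduct_self_le_of_sum_eq_zero hL_psd.isHermitian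
      hL_ker (fun r hr hr' => hlam2.2 ⟨hr, hr'⟩) _ (hy0 t)
  set C := ∑ i, a ⬝ᵥ (B i *ᵥ y i) with hC
  have hquad : μ * A + 2 * C ≤ ∑ i, x i ⬝ᵥ (B i *ᵥ x i) := by
    have h1 : ∀ i, a ⬝ᵥ (B i *ᵥ a) + 2 * (a ⬝ᵥ (B i *ᵥ y i)) ≤ x i ⬝ᵥ (B i *ᵥ x i) := by
      intro i
      have hs : y i ⬝ᵥ (B i *ᵥ a) = a ⬝ᵥ (B i *ᵥ y i) := by
        rw [dotProduct_mulVec, ← mulVec_transpose, (hB_symm i).eq, dotProduct_comm]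
      have h := (hB_psd i).dotProduct_mulVec_nonneg (y i)
      rw [star_trivial] at h
      rw [hy, mulVec_add, dotProduct_add, add_dotProduct, add_dotProduct, hs]
      linarith
    have h2 := hB_lb.dotProduct_mulVec_nonneg a
    simp only [star_trivial, sub_mulVec, smul_mulVec, one_mulVec, sum_mulVec, dotProduct_sub,
      dotProduct_smul, dotProduct_sum, smul_eq_mul, ← hA] at h2
    have h3 := Finset.sum_le_sum fun i (_ : i ∈ Finset.univ) => h1 i
    rw [Finset.sum_add_distrib, ← Finset.mul_sum] at h3
    linarith
  have hcross : ∀ s : ℝ, -(M * (s ^ 2 * (m * A) + Y)) ≤ 4 * s * C := by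
    intro s
    have h := Finset.sum_le_sum fun i (_ : i ∈ Finset.univ) =>
      neg_mul_dotProduct_sub_le_of_le_smul_one (hB_psd i) (hB_ub i) s a (y i)
    simp only [Finset.sum_neg_distrib, ← Finset.mul_sum, Finset.sum_add_distrib,
      Finset.sum_sub_distrib, hay, Finset.sum_const, Finset.card_univ, Fintype.card_fin,
      nsmul_eq_mul] at h
    simp only [← hA, ← hY, ← hC] at h
    linarith
  set P := μ - ρ * m with hPdef
  set Q := c * lam2 - ρ with hQdef
  have hkey : 0 ≤ P * A + 2 * C + Q * Y := by
    have h := hcross (P / (m * M))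
    have e : m * M * (M * ((P / (m * M)) ^ 2 * (m * A) + Y)) = P ^ 2 * A + m * M ^ 2 * Y := by
      field_simp
    have e' : m * M * (4 * (P / (m * M)) * C) = 4 * P * C := by
      field_simp
    have h' := mul_le_mul_of_nonneg_left h (by positivity : 0 ≤ m * M)
    rw [mul_neg, e, e'] at h'
    have h'' := mul_le_mul_of_nonneg_right hprod hY0
    refine nonneg_of_mul_nonneg_right (b := P * A + 2 * C + Q * Y) ?_ hP
    nlinarith [mul_nonneg (sq_nonneg P) hA0, mul_nonneg hPQ.le hY0]
  rw [hnorm]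
  have := mul_le_mul_of_nonneg_left hlap hc.le
  rw [hPdef, hQdef] at hkey
  linarith
end

section
/- Let (Ω, F, P) be a probability space with a filtration (F_k)_{k∈ℕ}, let h ∈ ℕ₊, and let (W_k)_{k∈ℕ} be a sequence of nonnegative integrable random variables with W_k F_k-measurable. Suppose there are constants σ > 0, C > 0, ν ∈ [0,1), and k₀ ≥ h such that for all k ≥ k₀: E[W_k | F_{k−h}] ≤ (1 − 2σh/k) W_{k−h} + C k^{−(2−ν)} almost surely, and suppose 2σ ≥ 1 − ν. Then for every τ > 0, almost surely sup_{k≥2} k^{1−ν} (ln k)^{−(1+τ)} W_k < ∞; i.e., W_k = O((ln k)^{1+τ} / k^{1−ν}) almost surely. -/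
open MeasureTheory Filter

/-- A nonnegative supermartingale is almost surely bounded above. -/
theorem MeasureTheory.Supermartingale.ae_bddAbove_range_of_nonneg
    {Ω : Type*} {m0 : MeasurableSpace Ω} {μ : Measure Ω} [IsFiniteMeasure μ]
    {G : Filtration ℕ m0} {Y : ℕ → Ω → ℝ} (hY : Supermartingale Y G μ)
    (hnonneg : ∀ n, 0 ≤ᵐ[μ] Y n) :
    ∀ᵐ ω ∂μ, BddAbove (Set.range fun n => Y n ω) := by
  have hbound : ∀ n, eLpNorm ((-Y) n) 1 μ ≤ ((∫ ω, Y 0 ω ∂μ).toNNReal : ENNReal) := by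
    intro n
    rw [Pi.neg_apply, eLpNorm_neg, eLpNorm_one_eq_lintegral_enorm,
      ← ofReal_integral_norm_eq_lintegral_enorm (hY.integrable n)]
    refine ENNReal.ofReal_le_ofReal ?_
    have hnorm : ∫ ω, ‖Y n ω‖ ∂μ = ∫ ω, Y n ω ∂μ := by
      refine integral_congr_ae ?_
      filter_upwards [hnonneg n] with ω hω
      exact Real.norm_of_nonneg hω
    rw [hnorm]
    simpa using hY.setIntegral_le (Nat.zero_le n) MeasurableSet.univ
  filter_upwards [hY.neg.exists_ae_tendsto_of_bdd hbound] with ω ⟨c, hc⟩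
  have hlim : Tendsto (fun n => Y n ω) atTop (nhds (-c)) := by simpa using hc.neg
  exact hlim.bddAbove_range

/-- A nonnegative adapted process that is a supermartingale up to summable deterministic errors
is almost surely bounded above. -/
theorem MeasureTheory.ae_bddAbove_range_of_condExp_le_add
    {Ω : Type*} {m0 : MeasurableSpace Ω} {μ : Measure Ω} [IsFiniteMeasure μ]
    {G : Filtration ℕ m0} {U : ℕ → Ω → ℝ} {b : ℕ → ℝ}
    (hadapted : ∀ n, StronglyMeasurable[G n] (U n)) (hint : ∀ n, Integrable (U n) μ)
    (hnonneg : ∀ n, 0 ≤ᵐ[μ] U n) (hb : ∀ n, 0 ≤ b n) (hsum : Summable b)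
    (hdrift : ∀ n, ∀ᵐ ω ∂μ, (μ[U (n + 1) | G n]) ω ≤ U n ω + b n) :
    ∀ᵐ ω ∂μ, BddAbove (Set.range fun n => U n ω) := by
  set c : ℕ → ℝ := fun n => ∑' i, b i - ∑ i ∈ Finset.range n, b i with hc
  have hc_nonneg : ∀ n, 0 ≤ c n := fun n =>
    sub_nonneg.2 (hsum.sum_le_tsum _ fun i _ => hb i)
  have hc_succ : ∀ n, c n = b n + c (n + 1) := fun n => by
    simp only [hc, Finset.sum_range_succ]; ring
  have hsuper : Supermartingale (fun n => U n + fun _ => c n) G μ := by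
    refine supermartingale_nat (fun n => (hadapted n).add stronglyMeasurable_const)
      (fun n => (hint n).add (integrable_const _)) fun n => ?_
    filter_upwards [condExp_add (hint (n + 1)) (integrable_const (c (n + 1))) (G n),
      hdrift n] with ω hadd hω
    rw [hadd, Pi.add_apply, condExp_const (G.le n), Pi.add_apply, hc_succ n]
    linarith
  filter_upwards [hsuper.ae_bddAbove_range_of_nonneg fun n => by
    filter_upwards [hnonneg n] with ω hω
    exact add_nonneg hω (hc_nonneg n)] with ω ⟨B, hB⟩
  refine ⟨B, ?_⟩
  rintro _ ⟨n, rfl⟩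
  have hn : U n ω + c n ≤ B := hB ⟨n, rfl⟩
  have := hc_nonneg n
  dsimp only
  linarith

theorem Real.add_rpow_mul_one_sub_le {x y p : ℝ} (hx : 0 < x) (hy : 0 ≤ y) (hp0 : 0 ≤ p)
    (hp1 : p ≤ 1) : (x + y) ^ p * (1 - p * (y / x)) ≤ x ^ p := by
  have hyx : 0 ≤ y / x := by positivity
  have hfactor : (x + y) ^ p = x ^ p * (1 + y / x) ^ p := by
    rw [← Real.mul_rpow hx.le (by positivity)]
    congr 1
    field_simp
  have hbern : (1 + y / x) ^ p ≤ 1 + p * (y / x) :=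
    rpow_one_add_le_one_add_mul_self (by linarith) hp0 hp1
  have hle_one : (1 + y / x) ^ p * (1 - p * (y / x)) ≤ 1 := by
    have hpow : 0 ≤ (1 + y / x) ^ p := by positivity
    rcases le_total 0 (1 - p * (y / x)) with hs | hs
    · nlinarith [mul_le_mul_of_nonneg_right hbern hs, sq_nonneg (p * (y / x))]
    · nlinarith [mul_nonneg hpow (neg_nonneg.2 hs)]
  rw [hfactor, mul_assoc]
  exact mul_le_of_le_one_right (by positivity) hle_one

theorem Real.summable_inv_mul_log_rpow_neg {s : ℝ} (hs : 1 < s) :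
    Summable fun n : ℕ => (n : ℝ)⁻¹ * Real.log n ^ (-s) := by
  have hdouble : Summable fun n : ℕ => (n : ℝ)⁻¹ * Real.log (2 * n) ^ (-s) := by
    rw [← summable_condensed_iff_of_nonneg]
    · have hp : Summable fun k : ℕ => Real.log 2 ^ (-s) * ((k + 1 : ℕ) : ℝ) ^ (-s) :=
        ((summable_nat_add_iff 1).2 (Real.summable_nat_rpow.2 (by linarith))).mul_left _
      refine hp.congr fun k => ?_
      have hlog : Real.log (2 * ((2 ^ k : ℕ) : ℝ)) = Real.log 2 * ((k + 1 : ℕ) : ℝ) := by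
        rw [Nat.cast_pow, Nat.cast_ofNat, ← pow_succ', Real.log_pow, mul_comm]
      rw [hlog, Real.mul_rpow (Real.log_nonneg (by norm_num)) (by positivity)]
      push_cast
      field_simp
    · intro n
      rcases n.eq_zero_or_pos with rfl | hn
      · simp
      · have : (1 : ℝ) ≤ n := by exact_mod_cast hn
        have := Real.log_nonneg (show (1 : ℝ) ≤ 2 * n by linarith)
        positivity
    · intro m n hm hmn
      have hm' : (1 : ℝ) ≤ m := by exact_mod_cast hm
      have hmn' : (m : ℝ) ≤ n := by exact_mod_cast hmn
      have hlog : 0 < Real.log (2 * m) := Real.log_pos (by linarith)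
      have hlog' : 0 < Real.log (2 * n) := Real.log_pos (by linarith)
      refine mul_le_mul (inv_anti₀ (by linarith) hmn') ?_ (by positivity) (by positivity)
      exact Real.rpow_le_rpow_of_nonpos hlog
        (Real.log_le_log (by linarith) (by linarith)) (by linarith)
  refine Summable.of_nonneg_of_le (fun n => ?_) (fun n => ?_) (hdouble.mul_left ((2 : ℝ) ^ s))
  · have := Real.log_natCast_nonneg n
    positivity
  · rcases lt_or_ge n 2 with hn | hn
    · have hs0 : -s ≠ 0 := by linarith
      interval_cases n
      · simp
      · have := Real.log_nonneg (show (1 : ℝ) ≤ 2 by norm_num)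
        simp only [Nat.cast_one, Real.log_one, Real.zero_rpow hs0, mul_zero, mul_one]
        positivity
    · have hn' : (2 : ℝ) ≤ n := by exact_mod_cast hn
      have hlog : 0 < Real.log n := Real.log_pos (by linarith)
      have hlog2 : 0 < Real.log (2 * n) := Real.log_pos (by linarith)
      have hle : Real.log (2 * n) ≤ 2 * Real.log n := by
        rw [Real.log_mul (by norm_num) (by positivity)]
        linarith [Real.log_le_log (by norm_num) hn']
      have hpow : (2 * Real.log n) ^ (-s) ≤ Real.log (2 * n) ^ (-s) :=
        Real.rpow_le_rpow_of_nonpos hlog2 hle (by linarith)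
      rw [Real.mul_rpow (by norm_num) hlog.le, Real.rpow_neg (by norm_num)] at hpow
      have h2 : (0 : ℝ) < 2 ^ s := by positivity
      have hpow' : Real.log n ^ (-s) ≤ 2 ^ s * Real.log (2 * n) ^ (-s) :=
        (inv_mul_le_iff₀ h2).1 hpow
      calc (n : ℝ)⁻¹ * Real.log n ^ (-s)
          ≤ (n : ℝ)⁻¹ * (2 ^ s * Real.log (2 * n) ^ (-s)) := by gcongr
        _ = _ := by ring

/-- stochastic recursion rate lemma. Let `(W_k)` be nonnegative
integrable adapted random variables satisfying, for `k ≥ k₀`,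
`E[W_k | F_{k-h}] ≤ (1 - 2σh/k) W_{k-h} + C k^{-(2-ν)}` a.s., with `σ > 0`, `C > 0`,
`ν ∈ [0,1)`, `k₀ ≥ h`, and suppose `2σ ≥ 1 - ν`. Then for every `τ > 0`, almost
surely `sup_{k≥2} k^{1-ν} (ln k)^{-(1+τ)} W_k < ∞`. -/
theorem stochastic_recursion_rate_lemma
    {Ωs : Type*} {m0 : MeasurableSpace Ωs} {μ : Measure Ωs} [IsProbabilityMeasure μ]
    (F : Filtration ℕ m0) (h : ℕ) (hh : 1 ≤ h)
    (W : ℕ → Ωs → ℝ)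
    (hW_nonneg : ∀ k, ∀ᵐ ω ∂μ, 0 ≤ W k ω)
    (hW_int : ∀ k, Integrable (W k) μ)
    (hW_adapted : ∀ k, StronglyMeasurable[F k] (W k))
    (σ C ν : ℝ) (hσ : 0 < σ) (hC : 0 < C) (hν0 : 0 ≤ ν) (hν1 : ν < 1)
    (k₀ : ℕ) (hk₀ : h ≤ k₀)
    (hdrift : ∀ k, k₀ ≤ k →
      ∀ᵐ ω ∂μ, (μ[W k | F (k - h)]) ω ≤
        (1 - 2 * σ * h / k) * W (k - h) ω + C * (k : ℝ) ^ (-(2 - ν)))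
    (hgap : 1 - ν ≤ 2 * σ) :
    ∀ τ : ℝ, 0 < τ →
      ∀ᵐ ω ∂μ, ∃ B : ℝ, ∀ k : ℕ, 2 ≤ k →
        (k : ℝ) ^ (1 - ν) * (Real.log k) ^ (-(1 + τ)) * W k ω ≤ B := by
  intro τ hτ
  set p : ℝ := 1 - ν with hp
  set k₁ : ℕ := k₀ + 2 with hk₁
  let a : ℕ → ℝ := fun k => ((k : ℝ) + h) ^ p * Real.log k ^ (-(1 + τ))
  have hlog_nonneg : ∀ k : ℕ, 0 ≤ Real.log (k : ℝ) ^ (-(1 + τ)) := fun k =>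
    Real.rpow_nonneg (Real.log_natCast_nonneg k) _
  have ha_nonneg : ∀ k, 0 ≤ a k := fun k =>
    mul_nonneg (by positivity) (hlog_nonneg k)
  have hstep : ∀ j : ℕ, k₁ ≤ j → ∀ᵐ ω ∂μ,
      (μ[a (j + h) • W (j + h) | F j]) ω ≤ (a j • W j) ω
        + 2 * C * (((j + h : ℕ) : ℝ)⁻¹ * Real.log (j + h : ℕ) ^ (-(1 + τ))) := by
    intro j hj
    have hdrift_j := hdrift (j + h) (by omega)
    rw [Nat.add_sub_cancel] at hdrift_j
    filter_upwards [hdrift_j, hW_nonneg j,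
      condExp_smul (μ := μ) (a (j + h)) (W (j + h)) (F j)] with ω hω hWω hsmul
    rw [hsmul, Pi.smul_apply, Pi.smul_apply, smul_eq_mul, smul_eq_mul]
    have hj2 : (2 : ℝ) ≤ j := by exact_mod_cast (by omega : 2 ≤ j)
    have hhj : (h : ℝ) ≤ j := by exact_mod_cast (by omega : h ≤ j)
    have hh0 : (0 : ℝ) ≤ h := Nat.cast_nonneg h
    set k : ℝ := ((j + h : ℕ) : ℝ) with hk
    have hkj : k = j + h := by rw [hk, Nat.cast_add]
    have hk0 : 0 < k := by linarith
    set l : ℝ := Real.log k ^ (-(1 + τ)) with hl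
    have hl0 : 0 ≤ l := hlog_nonneg (j + h)
    have hl_le : l ≤ Real.log j ^ (-(1 + τ)) :=
      Real.rpow_le_rpow_of_nonpos (Real.log_pos (by linarith))
        (Real.log_le_log (by linarith) (by linarith)) (by linarith)
    have hcoef : 1 - 2 * σ * h / k ≤ 1 - p * (h / k) := by
      rw [mul_div_assoc]
      gcongr
    have hmain : (k + h) ^ p * (1 - p * (h / k)) ≤ k ^ p :=
      Real.add_rpow_mul_one_sub_le hk0 hh0 (by linarith) (by linarith)
    have herror : (k + h) ^ p * k ^ (-(2 - ν)) ≤ 2 * k⁻¹ := by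
      have hdouble : (k + h) ^ p ≤ 2 * k ^ p :=
        calc (k + h) ^ p ≤ (2 * k) ^ p :=
              Real.rpow_le_rpow (by linarith) (by linarith) (by linarith)
          _ = 2 ^ p * k ^ p := Real.mul_rpow (by norm_num) hk0.le
          _ ≤ 2 * k ^ p := by
              gcongr
              exact Real.rpow_le_self_of_one_le (by norm_num) (by linarith)
      calc (k + h) ^ p * k ^ (-(2 - ν)) ≤ 2 * k ^ p * k ^ (-(2 - ν)) := by gcongr
        _ = 2 * k⁻¹ := by
            rw [mul_assoc, ← Real.rpow_add hk0, ← Real.rpow_neg_one]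
            congr 2
            rw [hp]; ring
    have ha : a (j + h) = (k + h) ^ p * l := rfl
    calc a (j + h) * (μ[W (j + h) | F j]) ω
        ≤ a (j + h) * ((1 - p * (h / k)) * W j ω + C * k ^ (-(2 - ν))) := by
          refine mul_le_mul_of_nonneg_left (hω.trans ?_) (ha_nonneg _)
          gcongr
      _ = (k + h) ^ p * (1 - p * (h / k)) * (l * W j ω)
            + (k + h) ^ p * k ^ (-(2 - ν)) * (C * l) := by rw [ha]; ring
      _ ≤ k ^ p * (l * W j ω) + 2 * k⁻¹ * (C * l) := by gcongr
      _ ≤ k ^ p * (Real.log j ^ (-(1 + τ)) * W j ω) + 2 * k⁻¹ * (C * l) := by gcongr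
      _ = a j * W j ω + 2 * C * (k⁻¹ * l) := by
          simp only [a, ← hkj]; ring
  have hclass : ∀ r : ℕ, ∀ᵐ ω ∂μ,
      BddAbove (Set.range fun n : ℕ => (a (k₁ + r + n * h) • W (k₁ + r + n * h)) ω) := by
    intro r
    let G : Filtration ℕ m0 :=
      ⟨fun n => F (k₁ + r + n * h), fun m n hmn => F.mono (by gcongr), fun n => F.le _⟩
    have hinj : Function.Injective fun n : ℕ => k₁ + r + n * h + h := by
      intro m n hmn
      exact Nat.eq_of_mul_eq_mul_right hh (by simpa using hmn)
    refine ae_bddAbove_range_of_condExp_le_add (G := G)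
      (U := fun n => a (k₁ + r + n * h) • W (k₁ + r + n * h))
      (fun n => (hW_adapted _).const_smul _) (fun n => (hW_int _).smul _) (fun n => ?_)
      (fun n => ?_)
      (((Real.summable_inv_mul_log_rpow_neg (by linarith : 1 < 1 + τ)).comp_injective
        hinj).mul_left (2 * C)) fun n => ?_
    · filter_upwards [hW_nonneg (k₁ + r + n * h)] with ω hω
      exact mul_nonneg (ha_nonneg _) hω
    · exact mul_nonneg (by positivity) (mul_nonneg (by positivity) (hlog_nonneg _))
    · have hidx : k₁ + r + (n + 1) * h = k₁ + r + n * h + h := by ring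
      simp only [hidx]
      exact hstep (k₁ + r + n * h) (by omega)
  filter_upwards [ae_all_iff.2 hclass, ae_all_iff.2 hW_nonneg] with ω hbdd hWω
  choose B hB using hbdd
  obtain ⟨M, hM⟩ := ((Finset.range h).image B ∪ (Finset.range k₁).image
    fun k : ℕ => (k : ℝ) ^ p * Real.log k ^ (-(1 + τ)) * W k ω).exists_le
  refine ⟨M, fun k _ => ?_⟩
  rcases lt_or_ge k k₁ with hk | hk
  · exact hM _ (Finset.mem_union_right _ (Finset.mem_image_of_mem _ (Finset.mem_range.2 hk)))
  · have hidx : k₁ + (k - k₁) % h + (k - k₁) / h * h = k := by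
      have := Nat.mod_add_div' (k - k₁) h
      omega
    have hle : (a k • W k) ω ≤ B ((k - k₁) % h) := by
      have := hB ((k - k₁) % h) ⟨(k - k₁) / h, rfl⟩
      simpa only [hidx] using this
    have hBM : B ((k - k₁) % h) ≤ M :=
      hM _ (Finset.mem_union_left _ (Finset.mem_image_of_mem _
        (Finset.mem_range.2 (Nat.mod_lt _ hh))))
    refine le_trans ?_ (hle.trans hBM)
    refine mul_le_mul_of_nonneg_right (mul_le_mul_of_nonneg_right ?_ (hlog_nonneg k)) (hWω k)
    exact Real.rpow_le_rpow (Nat.cast_nonneg k) (by simp) (by linarith)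
end
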